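/- Under the hypotheses of the previous item (Lévy density ξ(±x) ~ x^{-α-1} K_±(x) as x → 0+, α ∈ (1,2), k = lim K_- /K_+ ∈ [0,∞], zero Gaussian part), the imaginary part ω(λ) = bλ + ∫ℝ (λx·1_{|x|<1} - sin λx) ν(dx) satisfies ω(λ)/(λ^α (K_+(1/λ)+K_-(1/λ))) → ((1-k)/(1+k)) · (π C_α / α) as λ → ∞, where C_α = (1/π)∫₀^∞ (1-cos x)/x^α dx. -/

import Mathlib

open MeasureTheory Set Filter Topology Real

/-- `L` is slowly varying at `0+`. -/
def SlowlyVaryingAtZero (L : ℝ → ℝ) : Prop :=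
  Measurable L ∧ (∀ᶠ x in 𝓝[>] (0:ℝ), 0 < L x) ∧
    ∀ c : ℝ, 0 < c →
      Tendsto (fun x : ℝ => L (c * x) / L x) (𝓝[>] (0:ℝ)) (𝓝 1)

lemma uct_bound (h : ℝ → ℝ) (hm : Measurable h)
    (hl : ∀ s, Tendsto (fun t => h (t + s) - h t) atTop (𝓝 0)) :
    ∃ T : ℝ, ∀ t ≥ T, ∀ s ∈ Icc (0:ℝ) 1, |h (t + s) - h t| ≤ 2 := by
  by_contra! hc
  choose t ht s hs hts using fun n : ℕ => hc n
  have htt : Tendsto t atTop atTop := tendsto_atTop_mono ht tendsto_natCast_atTop_atTop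
  have htt2 : Tendsto (fun n => t n + s n) atTop atTop :=
    tendsto_atTop_mono (fun n => by linarith [(hs n).1]) htt
  have key : ∀ r : ℕ → ℝ, Tendsto r atTop atTop →
      ∀ᶠ n in atTop, volume ({x | 1 ≤ |h (r n + x) - h (r n)|} ∩ Icc (0:ℝ) 3) < 1 / 2 := by
    intro r hr
    have h1 : TendstoInMeasure (volume.restrict (Icc (0:ℝ) 3))
        (fun n x => h (r n + x) - h (r n)) atTop (fun _ => 0) := by
      apply tendstoInMeasure_of_tendsto_ae
      · intro n
        exact ((hm.comp (measurable_const.add measurable_id)).sub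
          measurable_const).aestronglyMeasurable
      · exact Eventually.of_forall fun x => (hl x).comp hr
    have h2 := h1 1 (by norm_num)
    have h3 := h2.eventually (gt_mem_nhds (show (0:ENNReal) < 1/2 by simp))
    filter_upwards [h3] with n hn
    rw [Measure.restrict_apply] at hn
    · refine lt_of_le_of_lt (measure_mono ?_) hn
      rintro x ⟨hx, hx2⟩
      refine ⟨?_, hx2⟩
      simp only [mem_ofPred_eq] at hx ⊢
      rw [edist_dist, Real.dist_eq, sub_zero]
      exact ENNReal.one_le_ofReal.2 hx
    · apply measurableSet_le measurable_const
      exact ((hm.comp (measurable_const.add measurable_id)).sub measurable_const).edist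
        measurable_const
  obtain ⟨n, hn1, hn2⟩ := ((key t htt).and (key _ htt2)).exists
  set A := {x | 1 ≤ |h (t n + x) - h (t n)|} ∩ Icc (0:ℝ) 3
  set B := {x | 1 ≤ |h (t n + s n + x) - h (t n + s n)|} ∩ Icc (0:ℝ) 3
  have hB : volume ((fun x => x + (-(s n))) ⁻¹' B) < 1 / 2 := by
    rwa [measure_preimage_add_right]
  have hsub : ¬ (Icc (1:ℝ) 2 ⊆ A ∪ (fun x => x + (-(s n))) ⁻¹' B) := by
    intro hsub
    have := (measure_mono hsub).trans (measure_union_le (μ := volume) _ _)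
    have h2 := this.trans_lt (ENNReal.add_lt_add hn1 hB)
    rw [Real.volume_Icc, ENNReal.add_halves] at h2
    norm_num at h2
  obtain ⟨y, hy, hyn⟩ := not_subset.1 hsub
  have hs1 := (hs n).1
  have hs2 := (hs n).2
  simp only [A, B, mem_union, mem_inter_iff, mem_ofPred_eq, mem_preimage, mem_Icc, not_or,
    not_and, not_le] at hyn
  have e1 : |h (t n + y) - h (t n)| < 1 := by
    by_contra! hcc
    have := hyn.1 hcc (by linarith [hy.1])
    linarith [hy.2]
  have e2 : |h (t n + y) - h (t n + s n)| < 1 := by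
    by_contra! hcc
    have := hyn.2 (by
        have e : t n + s n + (y + -s n) = t n + y := by ring
        rw [e]; exact hcc) (by linarith [hy.1])
    linarith [hy.2]
  have := hts n
  rw [abs_lt] at e1 e2
  rcases lt_abs.1 this with h | h <;> linarith

lemma potter_add (h : ℝ → ℝ) (hm : Measurable h)
    (hl : ∀ s, Tendsto (fun t => h (t + s) - h t) atTop (𝓝 0)) (η : ℝ) (hη : 0 < η) :
    ∃ T : ℝ, ∀ t ≥ T, ∀ s ≥ T, |h s - h t| ≤ 2 + η * |s - t| := by
  obtain ⟨T, hT⟩ := uct_bound h hm hl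
  obtain ⟨T', hT'⟩ := eventually_atTop.1 ((hl 1).eventually (Metric.ball_mem_nhds 0 hη))
  have step : ∀ n : ℕ, ∀ t ≥ T', |h (t + n) - h t| ≤ η * n := by
    intro n t ht
    induction n with
    | zero => simp
    | succ n ih =>
      have : dist (h (t + n + 1) - h (t + n)) 0 < η := hT' (t + n) (by
        have : (0:ℝ) ≤ n := n.cast_nonneg
        linarith)
      rw [Real.dist_eq, sub_zero] at this
      push_cast
      have e : h (t + (n + 1)) - h t = (h (t + n + 1) - h (t + n)) + (h (t + n) - h t) := by
        rw [add_assoc]; ring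
      rw [e]
      refine (abs_add_le _ _).trans ?_
      linarith
  have main : ∀ t ≥ max T T', ∀ s ≥ t, |h s - h t| ≤ 2 + η * |s - t| := by
    intro t ht s hs
    have h0 : 0 ≤ s - t := by linarith
    set n := ⌊s - t⌋₊
    have hn := Nat.floor_le h0
    have hn2 := Nat.lt_floor_add_one (s - t)
    have hn0 : (0:ℝ) ≤ n := n.cast_nonneg
    have a1 := step n t (le_trans (le_max_right _ _) ht)
    have a2 := hT (t + n) (by linarith [le_max_left T T']) (s - t - n)
      ⟨by linarith, by linarith⟩
    have e : h s - h t = (h (t + n + (s - t - n)) - h (t + n)) + (h (t + n) - h t) := by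
      have : t + n + (s - t - n) = s := by ring
      rw [this]; ring
    rw [e, abs_of_nonneg h0]
    refine (abs_add_le _ _).trans ?_
    have : η * n ≤ η * (s - t) := by gcongr
    linarith
  refine ⟨max T T', fun t ht s hs => ?_⟩
  rcases le_total t s with hst | hst
  · exact main t ht s hst
  · rw [abs_sub_comm, abs_sub_comm s t]
    exact main s hs t hst

lemma potter (L : ℝ → ℝ) (hL : SlowlyVaryingAtZero L) (η : ℝ) (hη : 0 < η) :
    ∃ δ > 0, ∃ C > 0, δ ≤ 1 ∧ (∀ x ∈ Ioc 0 δ, 0 < L x) ∧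
      ∀ x ∈ Ioc 0 δ, ∀ y ∈ Ioc 0 δ, L y / L x ≤ C * ((y / x) ^ η + (y / x) ^ (-η)) := by
  obtain ⟨hm, hpos, hlim⟩ := hL
  have hexp : Tendsto (fun t : ℝ => Real.exp (-t)) atTop (𝓝[>] (0:ℝ)) :=
    tendsto_nhdsWithin_iff.2 ⟨Real.tendsto_exp_neg_atTop_nhds_zero,
      Eventually.of_forall fun t => Real.exp_pos _⟩
  have hpos' := hexp.eventually hpos
  have hl : ∀ s, Tendsto (fun t => Real.log (L (Real.exp (-(t + s)))) -
      Real.log (L (Real.exp (-t)))) atTop (𝓝 0) := by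
    intro s
    have h1 := ((hlim (Real.exp (-s)) (Real.exp_pos _)).comp hexp).log one_ne_zero
    rw [Real.log_one] at h1
    refine h1.congr' ?_
    have hp2 := (tendsto_atTop_add_const_right atTop s tendsto_id).eventually hpos'
    filter_upwards [hpos', hp2] with t ht ht2
    simp only [id] at ht2
    have e : Real.exp (-s) * Real.exp (-t) = Real.exp (-(t + s)) := by
      rw [← Real.exp_add]; congr 1; ring
    simp only [Function.comp]
    rw [e, Real.log_div ht2.ne' ht.ne']
  obtain ⟨T, hT⟩ := potter_add (fun t => Real.log (L (Real.exp (-t))))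
    (Real.measurable_log.comp (hm.comp (Real.measurable_exp.comp measurable_neg))) hl η hη
  obtain ⟨δ₀, hδ₀, hsub⟩ := mem_nhdsGT_iff_exists_Ioc_subset.1 hpos
  have hδp : 0 < min 1 (min (Real.exp (-T)) δ₀) :=
    lt_min one_pos (lt_min (Real.exp_pos _) hδ₀)
  have hLp : ∀ x ∈ Ioc 0 (min 1 (min (Real.exp (-T)) δ₀)), 0 < L x := fun x hx =>
    hsub ⟨hx.1, hx.2.trans ((min_le_right _ _).trans (min_le_right _ _))⟩
  have hle : ∀ x ∈ Ioc 0 (min 1 (min (Real.exp (-T)) δ₀)), -Real.log x ≥ T := by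
    intro x hx
    have := Real.log_le_log hx.1 (hx.2.trans ((min_le_right _ _).trans (min_le_left _ _)))
    rw [Real.log_exp] at this
    linarith
  refine ⟨_, hδp, Real.exp 2, Real.exp_pos _, min_le_left _ _, hLp, ?_⟩
  intro x hx y hy
  have h1 := hT (-Real.log x) (hle x hx) (-Real.log y) (hle y hy)
  simp only [neg_neg, Real.exp_log hx.1, Real.exp_log hy.1] at h1
  have hxy : 0 < y / x := div_pos hy.1 hx.1
  have h2 : -Real.log y - -Real.log x = -Real.log (y / x) := by
    rw [Real.log_div hy.1.ne' hx.1.ne']; ring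
  rw [← Real.log_div (hLp y hy).ne' (hLp x hx).ne', h2, abs_neg] at h1
  have h3 : L y / L x ≤ Real.exp (2 + η * |Real.log (y / x)|) := by
    rw [← Real.log_le_iff_le_exp (div_pos (hLp y hy) (hLp x hx))]
    exact (le_abs_self _).trans h1
  refine h3.trans ?_
  rw [Real.exp_add]
  refine mul_le_mul_of_nonneg_left ?_ (Real.exp_pos _).le
  rw [Real.rpow_def_of_pos hxy, Real.rpow_def_of_pos hxy]
  rcases abs_cases (Real.log (y / x)) with ⟨h, -⟩ | ⟨h, -⟩ <;> rw [h]
  · rw [mul_comm]; linarith [Real.exp_pos (Real.log (y / x) * -η)]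
  · rw [show η * -Real.log (y / x) = Real.log (y / x) * -η by ring]
    linarith [Real.exp_pos (Real.log (y / x) * η)]

lemma sub_sin_nonneg {t : ℝ} (ht : 0 ≤ t) : 0 ≤ t - Real.sin t := by
  linarith [Real.sin_le ht]

lemma sub_sin_le_two_mul {t : ℝ} (ht : 0 ≤ t) : t - Real.sin t ≤ 2 * t := by
  have := Real.abs_sin_le_abs (x := t)
  rw [abs_of_nonneg ht] at this
  linarith [(abs_le.1 this).1]

lemma abs_sub_sin_le_sq (t : ℝ) : |t - Real.sin t| ≤ 2 * t ^ 2 := by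
  have key : ∀ t : ℝ, 0 ≤ t → |t - Real.sin t| ≤ 2 * t ^ 2 := by
    intro t ht
    rw [abs_of_nonneg (sub_sin_nonneg ht)]
    rcases ht.eq_or_lt with rfl | h0
    · simp
    rcases le_total t 1 with h | h
    · have := Real.sin_gt_sub_cube h0
      nlinarith [mul_nonneg (mul_nonneg ht ht) (sub_nonneg.2 h), sq_nonneg t]
    · have := sub_sin_le_two_mul ht
      nlinarith
  rcases le_total 0 t with h | h
  · exact key t h
  · have := key (-t) (by linarith)
    rw [Real.sin_neg] at this
    rw [← abs_neg]
    convert this using 2 <;> ring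

lemma integrable_sub_sin {β : ℝ} (h1 : 1 < β) (h2 : β < 2) :
    IntegrableOn (fun u : ℝ => (u - Real.sin u) * u ^ (-β - 1)) (Ioi 0) := by
  have hcont : ContinuousOn (fun u : ℝ => (u - Real.sin u) * u ^ (-β - 1)) (Ioi 0) := by
    refine ContinuousOn.mul (by fun_prop) ?_
    exact fun x hx => (Real.continuousAt_rpow_const x _ (Or.inl (ne_of_gt hx))).continuousWithinAt
  have hun : Ioi (0:ℝ) = Ioo 0 1 ∪ Ici 1 := by
    ext x; simp only [mem_Ioi, mem_union, mem_Ioo, mem_Ici]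
    constructor
    · intro h; rcases lt_or_ge x 1 with h' | h'
      · exact Or.inl ⟨h, h'⟩
      · exact Or.inr h'
    · rintro (h | h) <;> linarith
  have hmeas := hcont.aestronglyMeasurable (μ := volume) measurableSet_Ioi
  rw [hun]
  refine IntegrableOn.union ?_ ?_
  · have hi : IntegrableOn (fun x : ℝ => 2 * x ^ (1 - β)) (Ioo 0 1) :=
      ((intervalIntegral.integrableOn_Ioo_rpow_iff one_pos).2 (by linarith)).const_mul 2
    refine Integrable.mono' hi (hmeas.mono_measure (Measure.restrict_mono
      (by rw [hun]; exact subset_union_left) le_rfl)) ?_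
    filter_upwards [ae_restrict_mem measurableSet_Ioo] with u hu
    rw [norm_mul, Real.norm_eq_abs, Real.norm_of_nonneg (Real.rpow_nonneg hu.1.le _)]
    have e : 2 * u ^ (1 - β) = 2 * u ^ 2 * u ^ (-β - 1) := by
      rw [mul_assoc, ← Real.rpow_natCast, ← Real.rpow_add hu.1]; congr 2; push_cast; ring
    rw [e]
    exact mul_le_mul_of_nonneg_right (abs_sub_sin_le_sq u) (Real.rpow_nonneg hu.1.le _)
  · rw [integrableOn_Ici_iff_integrableOn_Ioi]
    have hi : IntegrableOn (fun x : ℝ => 2 * x ^ (-β)) (Ioi 1) :=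
      (integrableOn_Ioi_rpow_of_lt (by linarith) one_pos).const_mul 2
    refine Integrable.mono' hi (hmeas.mono_measure (Measure.restrict_mono
      (Ioi_subset_Ioi zero_le_one) le_rfl)) ?_
    filter_upwards [ae_restrict_mem measurableSet_Ioi] with u hu
    have hu0 : 0 < u := lt_trans one_pos hu
    rw [norm_mul, Real.norm_of_nonneg (sub_sin_nonneg hu0.le),
      Real.norm_of_nonneg (Real.rpow_nonneg hu0.le _)]
    have e : 2 * u ^ (-β) = 2 * u * u ^ (-β - 1) := by
      rw [mul_assoc]; nth_rewrite 2 [← Real.rpow_one u]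
      rw [← Real.rpow_add hu0]; congr 2; ring
    rw [e]
    exact mul_le_mul_of_nonneg_right (sub_sin_le_two_mul hu0.le) (Real.rpow_nonneg hu0.le _)

lemma integrable_one_sub_cos {β : ℝ} (h1 : 1 < β) (h2 : β < 2) :
    IntegrableOn (fun u : ℝ => (1 - Real.cos u) * u ^ (-β)) (Ioi 0) := by
  have hcont : ContinuousOn (fun u : ℝ => (1 - Real.cos u) * u ^ (-β)) (Ioi 0) := by
    refine ContinuousOn.mul (by fun_prop) ?_
    exact fun x hx => (Real.continuousAt_rpow_const x _ (Or.inl (ne_of_gt hx))).continuousWithinAt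
  have hun : Ioi (0:ℝ) = Ioo 0 1 ∪ Ici 1 := by
    ext x; simp only [mem_Ioi, mem_union, mem_Ioo, mem_Ici]
    constructor
    · intro h; rcases lt_or_ge x 1 with h' | h'
      · exact Or.inl ⟨h, h'⟩
      · exact Or.inr h'
    · rintro (h | h) <;> linarith
  have hmeas := hcont.aestronglyMeasurable (μ := volume) measurableSet_Ioi
  rw [hun]
  refine IntegrableOn.union ?_ ?_
  · have hi : IntegrableOn (fun x : ℝ => x ^ (2 - β)) (Ioo 0 1) :=
      ((intervalIntegral.integrableOn_Ioo_rpow_iff one_pos).2 (by linarith))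
    refine Integrable.mono' hi (hmeas.mono_measure (Measure.restrict_mono
      (by rw [hun]; exact subset_union_left) le_rfl)) ?_
    filter_upwards [ae_restrict_mem measurableSet_Ioo] with u hu
    rw [norm_mul, Real.norm_of_nonneg (sub_nonneg.2 (Real.cos_le_one u)),
      Real.norm_of_nonneg (Real.rpow_nonneg hu.1.le _)]
    have e : u ^ (2 - β) = u ^ 2 * u ^ (-β) := by
      rw [← Real.rpow_natCast, ← Real.rpow_add hu.1]; congr 1
    rw [e]
    refine mul_le_mul_of_nonneg_right ?_ (Real.rpow_nonneg hu.1.le _)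
    nlinarith [Real.one_sub_sq_div_two_le_cos (x := u)]
  · rw [integrableOn_Ici_iff_integrableOn_Ioi]
    have hi : IntegrableOn (fun x : ℝ => 2 * x ^ (-β)) (Ioi 1) :=
      (integrableOn_Ioi_rpow_of_lt (by linarith) one_pos).const_mul 2
    refine Integrable.mono' hi (hmeas.mono_measure (Measure.restrict_mono
      (Ioi_subset_Ioi zero_le_one) le_rfl)) ?_
    filter_upwards [ae_restrict_mem measurableSet_Ioi] with u hu
    have hu0 : 0 < u := lt_trans one_pos hu
    rw [norm_mul, Real.norm_of_nonneg (sub_nonneg.2 (Real.cos_le_one u)),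
      Real.norm_of_nonneg (Real.rpow_nonneg hu0.le _)]
    refine mul_le_mul_of_nonneg_right ?_ (Real.rpow_nonneg hu0.le _)
    linarith [Real.neg_one_le_cos u]

lemma integral_by_parts {β : ℝ} (h1 : 1 < β) (h2 : β < 2) :
    ∫ u in Ioi (0:ℝ), (u - Real.sin u) * u ^ (-β - 1) =
      (∫ u in Ioi (0:ℝ), (1 - Real.cos u) / u ^ β) / β := by
  have hβ : β ≠ 0 := by linarith
  have hz : Tendsto (fun u : ℝ => u ^ (2 - β)) (𝓝[>] 0) (𝓝 0) := by
    have := (Real.continuousAt_rpow_const 0 (2 - β) (Or.inr (by linarith))).tendsto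
    rw [Real.zero_rpow (by linarith)] at this
    exact this.mono_left nhdsWithin_le_nhds
  have hinf : Tendsto (fun u : ℝ => u ^ (-(β - 1))) atTop (𝓝 0) :=
    tendsto_rpow_neg_atTop (by linarith)
  have := integral_Ioi_mul_deriv_eq_deriv_mul (a := 0) (a' := (0:ℝ)) (b' := 0)
    (u := fun u => u - Real.sin u) (u' := fun u => 1 - Real.cos u)
    (v := fun u => -(u ^ (-β)) / β) (v' := fun u => u ^ (-β - 1))
    (fun x _ => (hasDerivAt_id x).sub (Real.hasDerivAt_sin x))
    (fun x hx => by
      have := ((Real.hasDerivAt_rpow_const (x := x) (p := -β)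
        (Or.inl (ne_of_gt hx))).neg).div_const β
      have e : -(-β * x ^ (-β - 1)) / β = x ^ (-β - 1) := by field_simp
      rw [e] at this
      exact this)
    (integrable_sub_sin h1 h2)
    (by
      have := (integrable_one_sub_cos h1 h2).div_const (-β)
      refine this.congr (Eventually.of_forall fun u => ?_)
      simp only [Pi.mul_apply]
      field_simp)
    (by
      have hz' := (hz.const_mul 2).div_const β
      simp only [mul_zero, zero_div] at hz'
      refine squeeze_zero_norm' ?_ hz'
      filter_upwards [self_mem_nhdsWithin] with u hu
      have hu0 : 0 < u := hu
      simp only [Pi.mul_apply]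
      rw [norm_mul, norm_div, norm_neg, Real.norm_of_nonneg (Real.rpow_nonneg hu0.le _),
        Real.norm_of_nonneg (by linarith : 0 ≤ β), ← mul_div_assoc]
      refine div_le_div_of_nonneg_right ?_ (by linarith)
      have e : 2 * u ^ (2 - β) = 2 * u ^ 2 * u ^ (-β) := by
        rw [mul_assoc, ← Real.rpow_natCast, ← Real.rpow_add hu0]; congr 2
      rw [e]
      exact mul_le_mul_of_nonneg_right (abs_sub_sin_le_sq u) (Real.rpow_nonneg hu0.le _))
    (by
      have hz' := (hinf.const_mul 2).div_const β
      simp only [mul_zero, zero_div] at hz'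
      refine squeeze_zero_norm' ?_ hz'
      filter_upwards [eventually_gt_atTop 0] with u hu0
      simp only [Pi.mul_apply]
      rw [norm_mul, norm_div, norm_neg, Real.norm_of_nonneg (Real.rpow_nonneg hu0.le _),
        Real.norm_of_nonneg (by linarith : 0 ≤ β), ← mul_div_assoc,
        Real.norm_of_nonneg (sub_sin_nonneg hu0.le)]
      refine div_le_div_of_nonneg_right ?_ (by linarith)
      have e : 2 * u ^ (-(β - 1)) = 2 * u * u ^ (-β) := by
        rw [mul_assoc]; nth_rewrite 2 [← Real.rpow_one u]
        rw [← Real.rpow_add hu0]; congr 2; ring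
      rw [e]
      exact mul_le_mul_of_nonneg_right (sub_sin_le_two_mul hu0.le) (Real.rpow_nonneg hu0.le _))
  rw [this, sub_zero, zero_sub, ← integral_neg, ← integral_div]
  refine setIntegral_congr_fun measurableSet_Ioi fun u hu => ?_
  have hu0 : 0 < u := hu
  simp only [Real.rpow_neg hu0.le]
  field_simp

lemma exists_good_density (ξ H : ℝ → ℝ) (hH : Measurable H)
    (hHp : ∀ᶠ x in 𝓝[≠] (0:ℝ), 0 < H x)
    (hlim : Tendsto (fun x => ξ x / H x) (𝓝[≠] (0:ℝ)) (𝓝 1)) :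
    ∃ g : ℝ → ℝ, Measurable g ∧ (∀ x, 0 ≤ g x) ∧
      volume.withDensity (fun x => ENNReal.ofReal (ξ x)) =
        volume.withDensity (fun x => ENNReal.ofReal (g x)) ∧
      Tendsto (fun x => g x / H x) (𝓝[≠] (0:ℝ)) (𝓝 1) := by
  obtain ⟨g0, hg0m, hg0le, hg0⟩ := exists_measurable_le_withDensity_eq volume
    (fun x => ENNReal.ofReal (ξ x))
  have hfin : ∀ x, g0 x ≠ ⊤ := fun x => ne_top_of_le_ne_top ENNReal.ofReal_ne_top (hg0le x)
  have hδ : ∀ n : ℕ, ∃ U : Set ℝ, MeasurableSet U ∧ U ∈ 𝓝[≠] (0:ℝ) ∧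
      ∀ᵐ x, x ∈ U → ENNReal.ofReal ((1 - 1 / ((n:ℝ) + 1)) * H x) ≤ g0 x := by
    intro n
    have hn : (0:ℝ) < 1 / ((n:ℝ) + 1) := by positivity
    have h1 := hlim.eventually (lt_mem_nhds (show 1 - 1 / ((n:ℝ) + 1) < 1 by linarith))
    obtain ⟨V, hVo, hV0, hVs⟩ := mem_nhdsWithin.1 (h1.and hHp)
    obtain ⟨U, hUm, hU, hUs⟩ : ∃ U : Set ℝ, MeasurableSet U ∧ U ∈ 𝓝[≠] (0:ℝ) ∧
        ∀ x ∈ U, 1 - 1 / ((n:ℝ) + 1) < ξ x / H x ∧ 0 < H x :=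
      ⟨V ∩ {0}ᶜ, hVo.measurableSet.inter (measurableSet_singleton 0).compl,
        mem_nhdsWithin.2 ⟨V, hVo, hV0, subset_rfl⟩, fun x hx => hVs hx⟩
    refine ⟨U, hUm, hU, ?_⟩
    have h2 : U.indicator (fun x => ENNReal.ofReal ((1 - 1 / ((n:ℝ) + 1)) * H x)) ≤ᵐ[volume] g0 := by
      apply ae_le_of_forall_setLIntegral_le_of_sigmaFinite
      · exact (measurable_const.mul hH).ennreal_ofReal.indicator hUm
      · intro s hs _
        rw [← withDensity_apply g0 hs, hg0, withDensity_apply _ hs]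
        refine lintegral_mono fun x => ?_
        by_cases hx : x ∈ U
        · rw [indicator_of_mem hx]
          obtain ⟨a1, a2⟩ := hUs x hx
          exact ENNReal.ofReal_le_ofReal ((lt_div_iff₀ a2).1 a1).le
        · rw [indicator_of_notMem hx]; exact zero_le
    filter_upwards [h2] with x hx hxU
    rwa [indicator_of_mem hxU] at hx
  choose U hUm hU hUae using hδ
  have hall := ae_all_iff.2 hUae
  obtain ⟨N, hNsub, hNm, hN0⟩ := exists_measurable_superset_of_null hall
  classical
  refine ⟨fun x => if x ∈ N then max (H x) 0 else (g0 x).toReal,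
    Measurable.ite hNm (hH.max measurable_const) hg0m.ennreal_toReal, fun x => ?_, ?_, ?_⟩
  · dsimp only; split_ifs
    · exact le_max_right _ _
    · exact ENNReal.toReal_nonneg
  · rw [← hg0]
    apply withDensity_congr_ae
    have : ∀ᵐ x, x ∉ N := measure_eq_zero_iff_ae_notMem.1 hN0
    filter_upwards [this] with x hx
    rw [if_neg hx, ENNReal.ofReal_toReal (hfin x)]
  · rw [Metric.tendsto_nhds]
    intro ε hε
    obtain ⟨n, hn⟩ := exists_nat_one_div_lt hε
    have h1 := hlim.eventually (gt_mem_nhds (show 1 < 1 + ε by linarith))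
    have h3 := hlim.eventually (lt_mem_nhds (show 0 < (1:ℝ) by norm_num))
    filter_upwards [h1, h3, hHp, hU n] with x hx1 hx3 hxp hxU
    rw [Real.dist_eq]
    by_cases hxN : x ∈ N
    · rw [if_pos hxN, max_eq_left hxp.le, div_self hxp.ne']; simpa using hε
    · rw [if_neg hxN]
      have hx' : ∀ n, x ∈ U n → ENNReal.ofReal ((1 - 1 / ((n:ℝ) + 1)) * H x) ≤ g0 x := by
        by_contra hc
        exact hxN (hNsub hc)
      have a1 : (1 - 1 / ((n:ℝ) + 1)) * H x ≤ (g0 x).toReal :=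
        (ENNReal.ofReal_le_iff_le_toReal (hfin x)).1 (hx' n hxU)
      have hξ0 : 0 ≤ ξ x := by
        rcases (div_pos_iff.1 hx3) with h | h
        · exact h.1.le
        · linarith [h.2]
      have a2 : (g0 x).toReal ≤ ξ x := ENNReal.toReal_le_of_le_ofReal hξ0 (hg0le x)
      have b1 : 1 - 1 / ((n:ℝ) + 1) ≤ (g0 x).toReal / H x := (le_div_iff₀ hxp).2 a1
      have b2 : (g0 x).toReal / H x ≤ ξ x / H x := div_le_div_of_nonneg_right a2 hxp.le
      rw [abs_lt]; constructor <;> linarith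

lemma inv_tendsto : Tendsto (fun l : ℝ => 1 / l) atTop (𝓝[>] (0:ℝ)) := by
  simp only [one_div]; exact tendsto_inv_atTop_nhdsGT_zero

lemma linear_negligible (L : ℝ → ℝ) (hL : SlowlyVaryingAtZero L) {α : ℝ} (hα : 1 < α) :
    Tendsto (fun l : ℝ => l / (l ^ α * L (1 / l))) atTop (𝓝 0) := by
  obtain ⟨δ, hδ, C, hC, -, hpos, hb⟩ := potter L hL ((α - 1) / 2) (by linarith)
  have hδm : δ ∈ Ioc 0 δ := ⟨hδ, le_rfl⟩
  have hLδ := hpos δ hδm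
  have h0 : Tendsto (fun l : ℝ => C * 2 * δ ^ ((α - 1) / 2) / L δ * l ^ (-((α - 1) / 2)))
      atTop (𝓝 0) := by
    simpa using (tendsto_rpow_neg_atTop (show 0 < (α - 1) / 2 by linarith)).const_mul
      (C * 2 * δ ^ ((α - 1) / 2) / L δ)
  refine squeeze_zero' ?_ ?_ h0
  · filter_upwards [eventually_ge_atTop (1 / δ), eventually_gt_atTop 0] with l hl hl0
    have hm : 1 / l ∈ Ioc 0 δ := ⟨by positivity, by rw [div_le_iff₀ hl0]; rw [div_le_iff₀ hδ] at hl; linarith⟩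
    have := hpos _ hm
    positivity
  · filter_upwards [eventually_ge_atTop (1 / δ), eventually_gt_atTop 0] with l hl hl0
    have hl1 : 1 ≤ δ * l := by rw [div_le_iff₀ hδ] at hl; linarith
    have hm : 1 / l ∈ Ioc 0 δ := ⟨by positivity, by rw [div_le_iff₀ hl0]; exact hl1⟩
    have hLl := hpos _ hm
    have h1 := hb _ hm δ hδm
    have e : δ / (1 / l) = δ * l := by field_simp
    rw [e] at h1
    have h2 : (δ * l) ^ (-((α - 1) / 2)) ≤ (δ * l) ^ ((α - 1) / 2) :=
      Real.rpow_le_rpow_of_exponent_le hl1 (by linarith)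
    have h3 : L δ / L (1 / l) ≤ C * 2 * (δ ^ ((α - 1) / 2) * l ^ ((α - 1) / 2)) := by
      rw [← Real.mul_rpow hδ.le hl0.le]
      refine h1.trans ?_
      rw [mul_assoc]
      refine mul_le_mul_of_nonneg_left ?_ hC.le
      linarith
    have e2 : l / (l ^ α * L (1 / l)) = l ^ (1 - α) / L δ * (L δ / L (1 / l)) := by
      rw [Real.rpow_sub hl0, Real.rpow_one]
      field_simp
    have e3 : l ^ (-((α - 1) / 2)) = l ^ (1 - α) * l ^ ((α - 1) / 2) := by
      rw [← Real.rpow_add hl0]; congr 1; ring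
    rw [e2, e3]
    calc l ^ (1 - α) / L δ * (L δ / L (1 / l))
        ≤ l ^ (1 - α) / L δ * (C * 2 * (δ ^ ((α - 1) / 2) * l ^ ((α - 1) / 2))) :=
          mul_le_mul_of_nonneg_left h3 (by positivity)
      _ = _ := by ring

lemma part_one (L : ℝ → ℝ) (hL : SlowlyVaryingAtZero L) {α : ℝ} (h1 : 1 < α) (h2 : α < 2)
    (g : ℝ → ℝ) (hgm : Measurable g) (hg0 : ∀ x, 0 ≤ g x)
    (hlim : Tendsto (fun x => g x / (x ^ (-α - 1) * L x)) (𝓝[>] (0:ℝ)) (𝓝 1)) :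
    ∃ δ > 0, δ ≤ 1 ∧ Tendsto (fun l : ℝ =>
      (∫ x in Ioo 0 δ, (l * x - Real.sin (l * x)) * g x) / (l ^ α * L (1 / l))) atTop
      (𝓝 (∫ u in Ioi (0:ℝ), (u - Real.sin u) * u ^ (-α - 1))) := by
  obtain ⟨η, hη, hη1, hη2⟩ : ∃ η > 0, 1 < α - η ∧ α + η < 2 := by
    refine ⟨min (α - 1) (2 - α) / 2, ?_, ?_, ?_⟩
    · have := lt_min (show 0 < α - 1 by linarith) (show 0 < 2 - α by linarith)
      linarith
    · linarith [min_le_left (α - 1) (2 - α)]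
    · linarith [min_le_right (α - 1) (2 - α)]
  obtain ⟨δ₁, hδ₁, C, hC, hδ₁1, hpos, hb⟩ := potter L hL η hη
  obtain ⟨δ₂, hδ₂, hsub⟩ := mem_nhdsGT_iff_exists_Ioc_subset.1
    (hlim.eventually (gt_mem_nhds (show (1:ℝ) < 2 by norm_num)))
  set δ := min δ₁ δ₂ with hδdef
  have hδ : 0 < δ := lt_min hδ₁ hδ₂
  have hgle : ∀ x ∈ Ioc 0 δ, g x ≤ 2 * (x ^ (-α - 1) * L x) := by
    intro x hx
    have a : g x / (x ^ (-α - 1) * L x) < 2 := hsub ⟨hx.1, hx.2.trans (min_le_right _ _)⟩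
    have b : 0 < x ^ (-α - 1) * L x :=
      mul_pos (Real.rpow_pos_of_pos hx.1 _) (hpos x ⟨hx.1, hx.2.trans (min_le_left _ _)⟩)
    exact ((div_lt_iff₀ b).1 a).le
  refine ⟨δ, hδ, (min_le_left _ _).trans hδ₁1, ?_⟩
  set F : ℝ → ℝ → ℝ := fun l u =>
    (Iio (l * δ)).indicator (fun u => (u - Real.sin u) * g (u / l)) u / (l * l ^ α * L (1 / l))
    with hF
  have hFint : ∀ᶠ l : ℝ in atTop, ∫ u in Ioi (0:ℝ), F l u =
      (∫ x in Ioo 0 δ, (l * x - Real.sin (l * x)) * g x) / (l ^ α * L (1 / l)) := by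
    filter_upwards [eventually_gt_atTop 0] with l hl
    have a := integral_comp_mul_left_Ioi
      ((Iio (l * δ)).indicator (fun u => (u - Real.sin u) * g (u / l))) 0 hl
    rw [mul_zero] at a
    have b : ∫ x in Ioi (0:ℝ), (Iio (l * δ)).indicator
        (fun u => (u - Real.sin u) * g (u / l)) (l * x) =
        ∫ x in Ioo 0 δ, (l * x - Real.sin (l * x)) * g x := by
      rw [← Ioi_inter_Iio, ← setIntegral_indicator measurableSet_Iio]
      refine setIntegral_congr_fun measurableSet_Ioi fun x _ => ?_
      by_cases hx : x < δ
      · rw [indicator_of_mem (show x ∈ Iio δ from hx), indicator_of_mem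
          (show l * x ∈ Iio (l * δ) from mul_lt_mul_of_pos_left hx hl)]
        rw [mul_div_cancel_left₀ _ hl.ne']
      · rw [indicator_of_notMem (show x ∉ Iio δ from hx), indicator_of_notMem
          (show l * x ∉ Iio (l * δ) from fun h => hx (lt_of_mul_lt_mul_left h hl.le))]
    rw [← b, a, hF, integral_div, smul_eq_mul]
    rw [mul_assoc, ← div_div, inv_mul_eq_div]
  refine Tendsto.congr' hFint ?_
  refine tendsto_integral_filter_of_dominated_convergence
    (fun u => 2 * C * ((u - Real.sin u) * u ^ (-(α - η) - 1) +
      (u - Real.sin u) * u ^ (-(α + η) - 1))) ?_ ?_ ?_ ?_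
  · refine Eventually.of_forall fun l => Measurable.aestronglyMeasurable ?_
    refine Measurable.div_const (Measurable.indicator ?_ measurableSet_Iio) _
    exact (measurable_id.sub Real.measurable_sin).mul (hgm.comp (measurable_id.div_const l))
  · filter_upwards [eventually_ge_atTop (1 / δ), eventually_gt_atTop 0] with l hl hl0
    have hl1 : 1 ≤ δ * l := by rw [div_le_iff₀ hδ] at hl; linarith
    have hm : 1 / l ∈ Ioc 0 δ := ⟨by positivity, by rw [div_le_iff₀ hl0]; exact hl1⟩
    have hm1 : 1 / l ∈ Ioc 0 δ₁ := ⟨hm.1, hm.2.trans (min_le_left _ _)⟩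
    have hLl := hpos _ hm1
    filter_upwards [ae_restrict_mem measurableSet_Ioi] with u hu
    have hu0 : 0 < u := hu
    have hs := sub_sin_nonneg hu0.le
    by_cases hx : u < l * δ
    · have hul : u / l ∈ Ioc 0 δ := ⟨by positivity, by rw [div_le_iff₀ hl0]; linarith⟩
      have hul1 : u / l ∈ Ioc 0 δ₁ := ⟨hul.1, hul.2.trans (min_le_left _ _)⟩
      have c1 := hgle _ hul
      have c2 := hb _ hm1 _ hul1
      have e1 : u / l / (1 / l) = u := by field_simp
      rw [e1] at c2
      have hden : 0 < l * l ^ α * L (1 / l) := by positivity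
      simp only [hF]
      rw [indicator_of_mem (show u ∈ Iio (l * δ) from hx), Real.norm_of_nonneg
        (div_nonneg (mul_nonneg hs (hg0 _)) hden.le)]
      have e2 : (u / l) ^ (-α - 1) = u ^ (-α - 1) * (l * l ^ α) := by
        rw [Real.div_rpow hu0.le hl0.le, div_eq_mul_inv, ← Real.rpow_neg hl0.le]
        congr 1
        rw [show -(-α - 1) = 1 + α by ring, Real.rpow_add hl0, Real.rpow_one]
      have e3 : u ^ (-(α - η) - 1) = u ^ (-α - 1) * u ^ η := by
        rw [← Real.rpow_add hu0]; congr 1; ring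
      have e4 : u ^ (-(α + η) - 1) = u ^ (-α - 1) * u ^ (-η) := by
        rw [← Real.rpow_add hu0]; congr 1; ring
      rw [e2] at c1
      rw [e3, e4]
      have hup : 0 ≤ u ^ (-α - 1) := Real.rpow_nonneg hu0.le _
      calc (u - Real.sin u) * g (u / l) / (l * l ^ α * L (1 / l))
          ≤ (u - Real.sin u) * (2 * (u ^ (-α - 1) * (l * l ^ α) * L (u / l))) /
              (l * l ^ α * L (1 / l)) :=
            div_le_div_of_nonneg_right (mul_le_mul_of_nonneg_left c1 hs) hden.le
        _ = 2 * (u - Real.sin u) * u ^ (-α - 1) * (L (u / l) / L (1 / l)) := by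
            have : l ^ α ≠ 0 := (Real.rpow_pos_of_pos hl0 α).ne'
            field_simp
        _ ≤ 2 * (u - Real.sin u) * u ^ (-α - 1) * (C * (u ^ η + u ^ (-η))) :=
            mul_le_mul_of_nonneg_left c2 (by positivity)
        _ = _ := by ring
    · simp only [hF]
      rw [indicator_of_notMem (show u ∉ Iio (l * δ) from hx), zero_div, norm_zero]
      have := Real.rpow_nonneg hu0.le (-(α - η) - 1)
      have := Real.rpow_nonneg hu0.le (-(α + η) - 1)
      positivity
  · exact ((integrable_sub_sin (β := α - η) hη1 (by linarith)).add
      (integrable_sub_sin (β := α + η) (by linarith) hη2)).const_mul (2 * C)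
  · filter_upwards [ae_restrict_mem measurableSet_Ioi] with u hu
    have hu0 : 0 < u := hu
    have hul : Tendsto (fun l : ℝ => u * (1 / l)) atTop (𝓝[>] (0:ℝ)) := by
      refine tendsto_nhdsWithin_iff.2 ⟨?_, ?_⟩
      · simpa using (inv_tendsto.mono_right nhdsWithin_le_nhds).const_mul u
      · filter_upwards [eventually_gt_atTop 0] with l hl
        exact mem_Ioi.2 (by positivity)
    have t1 := hlim.comp hul
    have t2 := (hL.2.2 u hu0).comp inv_tendsto
    have t3 := ((t1.mul t2).const_mul ((u - Real.sin u) * u ^ (-α - 1)))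
    rw [mul_one, mul_one] at t3
    refine t3.congr' ?_
    filter_upwards [eventually_gt_atTop (u / δ), eventually_gt_atTop 0,
      inv_tendsto.eventually hL.2.1, hul.eventually hL.2.1] with l hl hl0 hL1 hL2
    have hx : u < l * δ := (div_lt_iff₀ hδ).1 hl
    simp only [hF, Function.comp]
    rw [indicator_of_mem (show u ∈ Iio (l * δ) from hx)]
    rw [show u / l = u * (1 / l) by ring]
    have e2 : (u * (1 / l)) ^ (-α - 1) = u ^ (-α - 1) * (l * l ^ α) := by
      rw [mul_one_div, Real.div_rpow hu0.le hl0.le, div_eq_mul_inv, ← Real.rpow_neg hl0.le]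
      congr 1
      rw [show -(-α - 1) = 1 + α by ring, Real.rpow_add hl0, Real.rpow_one]
    rw [e2]
    have q1 : l ^ α ≠ 0 := (Real.rpow_pos_of_pos hl0 α).ne'
    have q2 : u ^ (-α - 1) ≠ 0 := (Real.rpow_pos_of_pos hu0 _).ne'
    have q3 := hL1.ne'
    have q4 := hL2.ne'
    generalize L (u * (1 / l)) = A at *
    generalize L (1 / l) = B at *
    generalize g (u * (1 / l)) = G at *
    generalize u ^ (-α - 1) = P at *
    generalize l ^ α = Q at *
    field_simp

lemma integrand_bound (l x : ℝ) (hl : 0 ≤ l) :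
    |l * x * (if |x| < 1 then (1:ℝ) else 0) - Real.sin (l * x)| ≤
      (2 * l ^ 2 + 1) * min (x ^ 2) 1 := by
  split_ifs with h
  · have h2 : x ^ 2 ≤ 1 := by rw [sq_le_one_iff_abs_le_one]; exact h.le
    rw [min_eq_left h2, mul_one]
    refine (abs_sub_sin_le_sq _).trans ?_
    nlinarith [sq_nonneg x]
  · have h2 : 1 ≤ x ^ 2 := by
      rw [one_le_sq_iff_one_le_abs]; exact not_lt.1 h
    rw [min_eq_right h2, mul_zero, zero_sub, abs_neg]
    nlinarith [Real.abs_sin_le_one (l * x), sq_nonneg l]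

lemma integrand_measurable (l : ℝ) :
    Measurable (fun x : ℝ => l * x * (if |x| < 1 then (1:ℝ) else 0) - Real.sin (l * x)) := by
  refine Measurable.sub (Measurable.mul (by fun_prop) (Measurable.ite ?_ measurable_const
    measurable_const)) (by fun_prop)
  exact measurableSet_lt (by fun_prop) measurable_const

lemma one_sided (L : ℝ → ℝ) (hL : SlowlyVaryingAtZero L) {α : ℝ} (h1 : 1 < α) (h2 : α < 2)
    (g : ℝ → ℝ) (hgm : Measurable g) (hg0 : ∀ x, 0 ≤ g x)
    (hint : Integrable (fun x => min (x ^ 2) 1 * g x))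
    (hlim : Tendsto (fun x => g x / (x ^ (-α - 1) * L x)) (𝓝[>] (0:ℝ)) (𝓝 1)) :
    Tendsto (fun l : ℝ =>
      (∫ x in Ioi (0:ℝ), (l * x * (if |x| < 1 then (1:ℝ) else 0) - Real.sin (l * x)) * g x)
        / (l ^ α * L (1 / l))) atTop
      (𝓝 (∫ u in Ioi (0:ℝ), (u - Real.sin u) * u ^ (-α - 1))) := by
  obtain ⟨δ, hδ, hδ1, hp⟩ := part_one L hL h1 h2 g hgm hg0 hlim
  have hgi : IntegrableOn g (Ici δ) := by
    refine Integrable.mono' ((hint.const_mul (1 / δ ^ 2)).integrableOn (s := Ici δ))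
      hgm.aestronglyMeasurable ?_
    filter_upwards [ae_restrict_mem measurableSet_Ici] with x hx
    have hx' : δ ≤ x := hx
    rw [Real.norm_of_nonneg (hg0 x), ← mul_assoc]
    have : δ ^ 2 ≤ min (x ^ 2) 1 := le_min (by gcongr) (by nlinarith)
    have h3 : 1 ≤ 1 / δ ^ 2 * min (x ^ 2) 1 := by
      rw [one_div, inv_mul_eq_div, le_div_iff₀ (by positivity), one_mul]; exact this
    nlinarith [hg0 x]
  have hF : ∀ l : ℝ, 0 ≤ l → Integrable
      (fun x => (l * x * (if |x| < 1 then (1:ℝ) else 0) - Real.sin (l * x)) * g x) := by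
    intro l hl
    refine Integrable.mono' (hint.const_mul (2 * l ^ 2 + 1))
      ((integrand_measurable l).mul hgm).aestronglyMeasurable (Eventually.of_forall fun x => ?_)
    rw [norm_mul, Real.norm_of_nonneg (hg0 x), Real.norm_eq_abs, ← mul_assoc]
    exact mul_le_mul_of_nonneg_right (integrand_bound l x hl) (hg0 x)
  have htail : Tendsto (fun l : ℝ =>
      (∫ x in Ici δ, (l * x * (if |x| < 1 then (1:ℝ) else 0) - Real.sin (l * x)) * g x)
        / (l ^ α * L (1 / l))) atTop (𝓝 0) := by
    have hz := (linear_negligible L hL h1).const_mul (2 * ∫ x in Ici δ, g x)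
    rw [mul_zero] at hz
    refine squeeze_zero_norm' ?_ hz
    filter_upwards [eventually_ge_atTop 1, inv_tendsto.eventually hL.2.1] with l hl hLl
    have hl0 : 0 < l := by linarith
    have hden : 0 < l ^ α * L (1 / l) := by positivity
    rw [norm_div, Real.norm_of_nonneg hden.le, mul_div_assoc']
    refine div_le_div_of_nonneg_right ?_ hden.le
    have := norm_integral_le_of_norm_le (μ := volume.restrict (Ici δ))
      (f := fun x => (l * x * (if |x| < 1 then (1:ℝ) else 0) - Real.sin (l * x)) * g x)
      (hgi.const_mul (2 * l)) (by
        refine Eventually.of_forall fun x => ?_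
        rw [norm_mul, Real.norm_of_nonneg (hg0 x), Real.norm_eq_abs]
        refine mul_le_mul_of_nonneg_right ?_ (hg0 x)
        refine (abs_sub _ _).trans ?_
        have hs := Real.abs_sin_le_one (l * x)
        have : |l * x * (if |x| < 1 then (1:ℝ) else 0)| ≤ l := by
          split_ifs with h
          · rw [mul_one, abs_mul, abs_of_pos hl0]; nlinarith
          · simpa using hl0.le
        linarith)
    refine this.trans (le_of_eq ?_)
    rw [integral_const_mul]; ring
  have := hp.add htail
  rw [add_zero] at this
  refine this.congr' ?_
  filter_upwards [eventually_gt_atTop 0] with l hl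
  rw [← add_div]
  congr 1
  have hun : Ioi (0:ℝ) = Ioo 0 δ ∪ Ici δ := (Ioo_union_Ici_eq_Ioi hδ).symm
  rw [hun, setIntegral_union (by
    rw [Set.disjoint_left]; intro x hx hx'; exact absurd hx.2 (not_lt.2 hx'))
    measurableSet_Ici (hF l hl.le).integrableOn (hF l hl.le).integrableOn]
  congr 1
  refine setIntegral_congr_fun measurableSet_Ioo fun x hx => ?_
  have : |x| < 1 := by rw [abs_of_pos hx.1]; linarith [hx.2]
  simp only [if_pos this, mul_one]

lemma tendsto_neg_lt : Tendsto (fun x : ℝ => -x) (𝓝[<] (0:ℝ)) (𝓝[>] (0:ℝ)) := by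
  refine tendsto_nhdsWithin_iff.2 ⟨?_, ?_⟩
  · have : Tendsto (fun x : ℝ => -x) (𝓝 0) (𝓝 (-0)) := continuous_neg.tendsto 0
    rw [neg_zero] at this
    exact this.mono_left nhdsWithin_le_nhds
  · filter_upwards [self_mem_nhdsWithin] with x hx
    exact mem_Ioi.2 (neg_pos.2 hx)

lemma tendsto_neg_gt : Tendsto (fun x : ℝ => -x) (𝓝[>] (0:ℝ)) (𝓝[<] (0:ℝ)) := by
  refine tendsto_nhdsWithin_iff.2 ⟨?_, ?_⟩
  · have : Tendsto (fun x : ℝ => -x) (𝓝 0) (𝓝 (-0)) := continuous_neg.tendsto 0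
    rw [neg_zero] at this
    exact this.mono_left nhdsWithin_le_nhds
  · filter_upwards [self_mem_nhdsWithin] with x hx
    exact mem_Iio.2 (neg_lt_zero.2 hx)

lemma ratio_limits (Kp Km : ℝ → ℝ) (hp : ∀ᶠ x in 𝓝[>] (0:ℝ), 0 < Kp x)
    (hm : ∀ᶠ x in 𝓝[>] (0:ℝ), 0 < Km x) (k : ENNReal)
    (hk : Tendsto (fun x : ℝ => ENNReal.ofReal (Km x / Kp x)) (𝓝[>] (0:ℝ)) (𝓝 k)) :
    Tendsto (fun x => Kp x / (Kp x + Km x)) (𝓝[>] (0:ℝ))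
      (𝓝 (if k = ⊤ then 0 else 1 / (1 + k.toReal))) := by
  have e : ∀ᶠ x in 𝓝[>] (0:ℝ), (1 + Km x / Kp x)⁻¹ = Kp x / (Kp x + Km x) := by
    filter_upwards [hp, hm] with x h1 h2
    field_simp
  split_ifs with h
  · subst h
    refine Tendsto.congr' e (tendsto_inv_atTop_zero.comp ?_)
    exact tendsto_atTop_add_const_left _ 1 (ENNReal.tendsto_ofReal_nhds_top.1 hk)
  · have h1 := (ENNReal.tendsto_toReal h).comp hk
    have h2 : Tendsto (fun x => Km x / Kp x) (𝓝[>] (0:ℝ)) (𝓝 k.toReal) := by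
      refine h1.congr' ?_
      filter_upwards [hp, hm] with x h1 h2
      simp only [Function.comp]
      rw [ENNReal.toReal_ofReal (by positivity)]
    have h3 : 1 + k.toReal ≠ 0 := by
      have := ENNReal.toReal_nonneg (a := k)
      linarith
    rw [one_div]
    exact Tendsto.congr' e ((h2.const_add 1).inv₀ h3)

theorem stmt7 (ν : Measure ℝ) (hν0 : ν {0} = 0)
    (hνint : ∫⁻ x, ENNReal.ofReal (min (x ^ 2) 1) ∂ν < ⊤)
    (ξ : ℝ → ℝ) (hξ : ν = MeasureTheory.volume.withDensity (fun x => ENNReal.ofReal (ξ x)))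
    (α : ℝ) (hα : α ∈ Set.Ioo (1:ℝ) 2)
    (Kp Km : ℝ → ℝ) (hKp : SlowlyVaryingAtZero Kp) (hKm : SlowlyVaryingAtZero Km)
    (hξp : Tendsto (fun x : ℝ => ξ x / (x ^ (-α - 1) * Kp x)) (𝓝[>] (0:ℝ)) (𝓝 1))
    (hξm : Tendsto (fun x : ℝ => ξ (-x) / (x ^ (-α - 1) * Km x)) (𝓝[>] (0:ℝ)) (𝓝 1))
    (k : ENNReal)
    (hk : Tendsto (fun x : ℝ => ENNReal.ofReal (Km x / Kp x)) (𝓝[>] (0:ℝ)) (𝓝 k))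
    (b : ℝ) (ω : ℝ → ℝ)
    (hω : ∀ l : ℝ, ω l = b * l
        + ∫ x, (l * x * (if |x| < 1 then (1:ℝ) else 0) - Real.sin (l * x)) ∂ν) :
    Tendsto (fun l : ℝ => ω l / (l ^ α * (Kp (1 / l) + Km (1 / l)))) atTop
      (𝓝 ((if k = ⊤ then (-1 : ℝ) else (1 - k.toReal) / (1 + k.toReal))
          * (π * ((1 / π) * ∫ x in Set.Ioi (0:ℝ), (1 - Real.cos x) / x ^ α) / α))) := by
  obtain ⟨hα1, hα2⟩ := hα
  set H : ℝ → ℝ := fun x => if 0 < x then x ^ (-α - 1) * Kp x else (-x) ^ (-α - 1) * Km (-x)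
    with hHdef
  have hHpos : ∀ x, 0 < x → H x = x ^ (-α - 1) * Kp x := fun x hx => if_pos hx
  have hHneg : ∀ x, x < 0 → H x = (-x) ^ (-α - 1) * Km (-x) := fun x hx =>
    if_neg (not_lt.2 hx.le)
  have hHm : Measurable H := by
    refine Measurable.ite measurableSet_Ioi ?_ ?_
    · exact (measurable_id.pow_const _).mul hKp.1
    · exact (measurable_neg.pow_const _).mul (hKm.1.comp measurable_neg)
  have hHp : ∀ᶠ x in 𝓝[≠] (0:ℝ), 0 < H x := by
    rw [← nhdsLT_sup_nhdsGT, eventually_sup]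
    constructor
    · filter_upwards [tendsto_neg_lt.eventually hKm.2.1, self_mem_nhdsWithin] with x hx hx0
      have hx0' : x < 0 := hx0
      rw [hHneg x hx0']
      exact mul_pos (Real.rpow_pos_of_pos (neg_pos.2 hx0') _) hx
    · filter_upwards [hKp.2.1, self_mem_nhdsWithin] with x hx hx0
      have hx0' : 0 < x := hx0
      rw [hHpos x hx0']
      exact mul_pos (Real.rpow_pos_of_pos hx0' _) hx
  have hHlim : Tendsto (fun x => ξ x / H x) (𝓝[≠] (0:ℝ)) (𝓝 1) := by
    rw [← nhdsLT_sup_nhdsGT, tendsto_sup]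
    constructor
    · refine (hξm.comp tendsto_neg_lt).congr' ?_
      filter_upwards [self_mem_nhdsWithin] with x hx
      simp only [Function.comp]
      rw [hHneg x hx, neg_neg]
    · refine hξp.congr' ?_
      filter_upwards [self_mem_nhdsWithin] with x hx
      rw [hHpos x hx]
  obtain ⟨g, hgm, hg0, hgν, hglim⟩ := exists_good_density ξ H hHm hHp hHlim
  rw [← nhdsLT_sup_nhdsGT, tendsto_sup] at hglim
  have hgp : Tendsto (fun x => g x / (x ^ (-α - 1) * Kp x)) (𝓝[>] (0:ℝ)) (𝓝 1) := by
    refine hglim.2.congr' ?_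
    filter_upwards [self_mem_nhdsWithin] with x hx
    rw [hHpos x hx]
  have hgn : Tendsto (fun x => g (-x) / (x ^ (-α - 1) * Km x)) (𝓝[>] (0:ℝ)) (𝓝 1) := by
    refine (hglim.1.comp tendsto_neg_gt).congr' ?_
    filter_upwards [self_mem_nhdsWithin] with x hx
    simp only [Function.comp]
    rw [hHneg (-x) (neg_lt_zero.2 hx), neg_neg]
  rw [hgν] at hξ
  have hgem : Measurable (fun x => ENNReal.ofReal (g x)) := hgm.ennreal_ofReal
  have hmin : Integrable (fun x : ℝ => min (x ^ 2) 1) ν := by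
    refine ⟨Measurable.aestronglyMeasurable (by fun_prop), ?_⟩
    rw [hasFiniteIntegral_iff_ofReal (Eventually.of_forall fun x => by positivity)]
    exact hνint
  have hint : Integrable (fun x => min (x ^ 2) 1 * g x) := by
    rw [hξ, integrable_withDensity_iff hgem
      (Eventually.of_forall fun x => ENNReal.ofReal_lt_top)] at hmin
    simpa only [ENNReal.toReal_ofReal (hg0 _)] using hmin
  have hint' : Integrable (fun x => min (x ^ 2) 1 * g (-x)) := by
    simpa only [neg_sq] using hint.comp_neg
  have hF : ∀ l : ℝ, 0 ≤ l → Integrable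
      (fun x => (l * x * (if |x| < 1 then (1:ℝ) else 0) - Real.sin (l * x)) * g x) := by
    intro l hl
    refine Integrable.mono' (hint.const_mul (2 * l ^ 2 + 1))
      ((integrand_measurable l).mul hgm).aestronglyMeasurable (Eventually.of_forall fun x => ?_)
    rw [norm_mul, Real.norm_of_nonneg (hg0 x), Real.norm_eq_abs, ← mul_assoc]
    exact mul_le_mul_of_nonneg_right (integrand_bound l x hl) (hg0 x)
  have hsplit : ∀ l : ℝ, 0 ≤ l → ω l = b * l
      + (∫ x in Ioi (0:ℝ), (l * x * (if |x| < 1 then (1:ℝ) else 0) - Real.sin (l * x)) * g x)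
      - ∫ x in Ioi (0:ℝ), (l * x * (if |x| < 1 then (1:ℝ) else 0) - Real.sin (l * x))
          * g (-x) := by
    intro l hl
    have e1 : ∫ x, (l * x * (if |x| < 1 then (1:ℝ) else 0) - Real.sin (l * x)) ∂ν =
        ∫ x, (l * x * (if |x| < 1 then (1:ℝ) else 0) - Real.sin (l * x)) * g x := by
      rw [hξ, integral_withDensity_eq_integral_toReal_smul hgem
        (Eventually.of_forall fun x => ENNReal.ofReal_lt_top)]
      refine integral_congr_ae (Eventually.of_forall fun x => ?_)
      simp only [ENNReal.toReal_ofReal (hg0 _), smul_eq_mul]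
      ring
    have e2 := intervalIntegral.integral_Iic_add_Ioi (b := 0) (hF l hl).integrableOn
      (hF l hl).integrableOn
    have e3 := integral_comp_neg_Ioi 0
      (fun x => (l * x * (if |x| < 1 then (1:ℝ) else 0) - Real.sin (l * x)) * g x)
    rw [neg_zero] at e3
    have e4 : ∫ x in Ioi (0:ℝ),
        (l * -x * (if |-x| < 1 then (1:ℝ) else 0) - Real.sin (l * -x)) * g (-x) =
        -∫ x in Ioi (0:ℝ), (l * x * (if |x| < 1 then (1:ℝ) else 0) - Real.sin (l * x))
          * g (-x) := by
      rw [← integral_neg]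
      refine integral_congr_ae (Eventually.of_forall fun x => ?_)
      simp only [abs_neg, mul_neg, Real.sin_neg]
      ring
    rw [hω, e1, ← e2, ← e3, e4]
    ring
  have tp := one_sided Kp hKp hα1 hα2 g hgm hg0 hint hgp
  have tm := one_sided Km hKm hα1 hα2 (fun x => g (-x)) (hgm.comp measurable_neg)
    (fun x => hg0 _) hint' hgn
  have tr := (ratio_limits Kp Km hKp.2.1 hKm.2.1 k hk).comp inv_tendsto
  have tl := (linear_negligible Kp hKp hα1).const_mul b
  have hfin := ((tl.mul tr).add (tp.mul tr)).sub (tm.mul (tr.const_sub 1))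
  rw [integral_by_parts hα1 hα2] at hfin
  set I := ∫ u in Ioi (0:ℝ), (1 - Real.cos u) / u ^ α
  have hlimeq : (if k = ⊤ then (-1 : ℝ) else (1 - k.toReal) / (1 + k.toReal))
          * (π * ((1 / π) * I) / α) =
      b * 0 * (if k = ⊤ then 0 else 1 / (1 + k.toReal)) +
        I / α * (if k = ⊤ then 0 else 1 / (1 + k.toReal)) -
        I / α * (1 - if k = ⊤ then 0 else 1 / (1 + k.toReal)) := by
    have e : π * ((1 / π) * I) = I := by field_simp
    rw [e]
    split_ifs with h
    · ring
    · have h3 : 1 + k.toReal ≠ 0 := by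
        have := ENNReal.toReal_nonneg (a := k)
        linarith
      have : α ≠ 0 := by linarith
      field_simp
      ring
  rw [hlimeq]
  refine hfin.congr' ?_
  filter_upwards [eventually_gt_atTop 0, inv_tendsto.eventually hKp.2.1,
    inv_tendsto.eventually hKm.2.1] with l hl hp hm
  rw [hsplit l hl.le]
  simp only [Function.comp]
  have q1 : l ^ α ≠ 0 := (Real.rpow_pos_of_pos hl α).ne'
  have q2 : Kp (1 / l) + Km (1 / l) ≠ 0 := by positivity
  generalize (∫ x in Ioi (0:ℝ), (l * x * (if |x| < 1 then (1:ℝ) else 0) - Real.sin (l * x))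
    * g x) = A
  generalize (∫ x in Ioi (0:ℝ), (l * x * (if |x| < 1 then (1:ℝ) else 0) - Real.sin (l * x))
    * g (-x)) = B
  generalize Kp (1 / l) = P at *
  generalize Km (1 / l) = Q at *
  generalize l ^ α = R at *
  field_simp
  ring
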